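/- arXiv:1708.03237 — 2 statements merged into one kernel-verified Lean document; each statement's English description precedes it below -/
import Mathlib

section
/- Let (G_j) be a sequence of finite graphs with e(G_j) → ∞ and ℓ(G_j) = O(√(e(G_j))) as j → ∞, fix r > 0, and set p_j = r/√(2e(G_j)). Then the total variation distance between the law of S_{p_j}(G_j) and the law of S̃_{p_j}(G_j) tends to 0 as j → ∞; consequently, for any random finite unlabeled graph H, S_{p_j}(G_j) converges in distribution to H if and only if S̃_{p_j}(G_j) converges in distribution to H. -/
open Filter Finset
open scoped Classical ENNReal

/-- A finite graph on vertex set `Fin n`, possibly with loops, without multiple edges. -/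
structure FinGraph where
  n : ℕ
  adj : Fin n → Fin n → Bool
  symm : ∀ i j, adj i j = adj j i

namespace FinGraph

/-- Number of vertices. -/
def v (G : FinGraph) : ℕ := G.n

/-- Number of non-loop edges. -/
def e (G : FinGraph) : ℕ :=
  ((univ : Finset (Fin G.n × Fin G.n)).filter
    (fun q => G.adj q.1 q.2 = true ∧ q.1 < q.2)).card

/-- Number of loops. -/
def loops (G : FinGraph) : ℕ :=
  ((univ : Finset (Fin G.n)).filter (fun i => G.adj i i = true)).card

/-- Degree of a vertex (number of neighbours via non-loop edges). -/
def deg (G : FinGraph) (i : Fin G.n) : ℕ :=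
  ((univ : Finset (Fin G.n)).filter (fun j => G.adj i j = true ∧ j ≠ i)).card

/-- A graph is loopless when no vertex is adjacent to itself. -/
def Loopless (G : FinGraph) : Prop := ∀ i, G.adj i i = false

/-- The induced subgraph on a set `S` of vertices. -/
def induce (G : FinGraph) (S : Finset (Fin G.n)) : FinGraph where
  n := S.card
  adj i j := G.adj (S.orderIsoOfFin rfl i).1 (S.orderIsoOfFin rfl j).1
  symm i j := G.symm _ _

/-- The graph obtained by discarding all isolated vertices (vertices in no edge,
loop or non-loop). -/
def core (G : FinGraph) : FinGraph :=
  G.induce ((univ : Finset (Fin G.n)).filter (fun i => ∃ j, G.adj i j = true))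

/-- Graph isomorphism. -/
def Iso (G H : FinGraph) : Prop :=
  ∃ eqv : Fin G.n ≃ Fin H.n, ∀ i j, G.adj i j = H.adj (eqv i) (eqv j)

/-- Average degree `d̄(G)`. -/
noncomputable def avgDeg (G : FinGraph) : ℝ :=
  (1 / (G.n : ℝ)) * ∑ i : Fin G.n, (G.deg i : ℝ)

/-- Square average degree `d²̄(G)`. -/
noncomputable def sqAvgDeg (G : FinGraph) : ℝ :=
  (1 / (G.n : ℝ)) * ∑ i : Fin G.n, (G.deg i : ℝ) ^ 2

/-- Edge density `ρ(G) = 2e(G)/v(G)²`. -/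
noncomputable def density (G : FinGraph) : ℝ :=
  2 * (G.e : ℝ) / (G.n : ℝ) ^ 2

end FinGraph

/-- Unlabeled finite graphs: isomorphism classes of finite graphs. -/
def UGraph := Quot FinGraph.Iso

/-- The isomorphism class of a finite graph. -/
def FinGraph.cls (G : FinGraph) : UGraph := Quot.mk _ G

/-- Probability that independent Bernoulli(min p 1) vertex selection picks exactly `S`. -/
noncomputable def sampleWeight (G : FinGraph) (p : ℝ) (S : Finset (Fin G.n)) : ℝ :=
  (min p 1) ^ S.card * (1 - min p 1) ^ (G.n - S.card)

/-- Law (pmf) of the `p`-sampling `S_p(G)`: keep each vertex independently with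
probability `min p 1`, take the induced subgraph, discard isolated vertices,
and pass to the isomorphism class. -/
noncomputable def pSampleLaw (G : FinGraph) (p : ℝ) : UGraph → ℝ := fun H =>
  ∑ S ∈ (univ : Finset (Fin G.n)).powerset,
    sampleWeight G p S * (if ((G.induce S).core).cls = H then 1 else 0)

/-- The graph on `Fin k` pulled back along a vertex sample `x`. -/
def seqGraph (G : FinGraph) (k : ℕ) (x : Fin k → Fin G.n) : FinGraph where
  n := k
  adj i j := G.adj (x i) (x j)
  symm i j := G.symm _ _

/-- Law (pmf) of the with-replacement `p`-sampling `S̃_p(G)`: draw `K ~ Poisson(p·v(G))`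
vertices uniformly with replacement, form the graph on `Fin K` in which `i, j` are joined
whenever `(x_i, x_j)` is an edge of `G`, discard isolated vertices, and pass to the
isomorphism class. -/
noncomputable def wrSampleLaw (G : FinGraph) (p : ℝ) : UGraph → ℝ := fun H =>
  ∑' k : ℕ,
    (Real.exp (-(p * (G.v : ℝ))) * (p * (G.v : ℝ)) ^ k / (Nat.factorial k : ℝ)) *
      ((((univ : Finset (Fin k → Fin G.n)).filter
          (fun x => ((seqGraph G k x).core).cls = H)).card : ℝ) / ((G.v : ℝ)) ^ k)

/-- Total variation distance `sup_A |P(A) − Q(A)|` between two pmf-style laws on a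
countable discrete space. -/
noncomputable def dTV {α : Type*} (f g : α → ℝ) : ℝ :=
  ⨆ A : Set α, |∑' x : A, (f x.1 - g x.1)|

/-- `∑_i d_i · 1[d_i > k·√(e(G))]`, the total degree of vertices of degree exceeding
`k·√(e(G))`. -/
noncomputable def tailDegSum (G : FinGraph) (k : ℝ) : ℝ :=
  ∑ i : Fin G.n,
    (if k * Real.sqrt (G.e : ℝ) < (G.deg i : ℝ) then (G.deg i : ℝ) else 0)

/-- A sequence of graphs is uniformly sampling regular. -/
def UniformlySamplingRegular (G : ℕ → FinGraph) : Prop :=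
  ∀ ε : ℝ, 0 < ε → ∃ k : ℝ, 0 < k ∧ ∀ j,
    (1 / ((G j).e : ℝ)) * tailDegSum (G j) k < ε

/-- `E[e(S_p(G)) · 1[e(S_p(G)) > M]]`, the tail expectation of the number of non-loop
edges of the `p`-sampled subgraph (discarding isolated vertices does not change it). -/
noncomputable def expEdgeTail (G : FinGraph) (p M : ℝ) : ℝ :=
  ∑ S ∈ (univ : Finset (Fin G.n)).powerset,
    sampleWeight G p S *
      (if M < ((G.induce S).e : ℝ) then ((G.induce S).e : ℝ) else 0)

/-- `E[e(S_p(G))]`, the expected number of non-loop edges of the `p`-sampled subgraph. -/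
noncomputable def expEdge (G : FinGraph) (p : ℝ) : ℝ :=
  ∑ S ∈ (univ : Finset (Fin G.n)).powerset,
    sampleWeight G p S * ((G.induce S).e : ℝ)

/-- Law (pmf on ℕ) of the number of non-loop edges of the `p`-sampled subgraph. -/
noncomputable def edgeLaw (G : FinGraph) (p : ℝ) (m : ℕ) : ℝ :=
  ∑ S ∈ (univ : Finset (Fin G.n)).powerset,
    sampleWeight G p S * (if (G.induce S).e = m then 1 else 0)

/-- Number of kept neighbours (via non-loop edges) of vertex `i` under the selection `S`. -/
def keptNbrCount (G : FinGraph) (S : Finset (Fin G.n)) (i : Fin G.n) : ℕ :=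
  ((univ : Finset (Fin G.n)).filter (fun j => G.adj i j = true ∧ j ≠ i ∧ j ∈ S)).card

/-- `Pr(D_i ≥ 2)`: the probability that vertex `i` is kept and has at least two kept
neighbours, under independent Bernoulli(min p 1) vertex selection. -/
noncomputable def probD2 (G : FinGraph) (p : ℝ) (i : Fin G.n) : ℝ :=
  ∑ S ∈ (univ : Finset (Fin G.n)).powerset,
    sampleWeight G p S * (if i ∈ S ∧ 2 ≤ keptNbrCount G S i then 1 else 0)

/-- Probability that some kept vertex has at least two kept neighbours. -/
noncomputable def probSomeD2 (G : FinGraph) (p : ℝ) : ℝ :=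
  ∑ S ∈ (univ : Finset (Fin G.n)).powerset,
    sampleWeight G p S * (if ∃ i ∈ S, 2 ≤ keptNbrCount G S i then 1 else 0)

/-- Number of isolated kept (non-loop) edges: both endpoints kept, and each endpoint has
exactly one kept neighbour. -/
def isoEdgeCount (G : FinGraph) (S : Finset (Fin G.n)) : ℕ :=
  ((univ : Finset (Fin G.n × Fin G.n)).filter (fun q =>
    G.adj q.1 q.2 = true ∧ q.1 < q.2 ∧ q.1 ∈ S ∧ q.2 ∈ S ∧
    keptNbrCount G S q.1 = 1 ∧ keptNbrCount G S q.2 = 1)).card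

namespace WR

def IsPull (G H : FinGraph) (f : Fin H.n → Fin G.n) : Prop :=
  ∀ i j, H.adj i j = G.adj (f i) (f j)

def mult {G : FinGraph} {k : ℕ} (f : Fin k → Fin G.n) (v : Fin G.n) : ℕ :=
  (univ.filter (fun i => f i = v)).card

noncomputable def coreMult (G : FinGraph) (y : Fin G.n → ℕ) (v : Fin G.n) : ℕ :=
  if ∃ w, 0 < y w ∧ G.adj v w = true then y v else 0

lemma exists_equiv {G : FinGraph} {k l : ℕ} (f : Fin k → Fin G.n) (g : Fin l → Fin G.n)
    (h : ∀ v, mult f v = mult g v) : ∃ e : Fin k ≃ Fin l, ∀ i, g (e i) = f i := by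
  have h' : ∀ v, Nonempty ({i // f i = v} ≃ {i // g i = v}) := fun v => by
    refine ⟨Fintype.equivOfCardEq ?_⟩
    rw [Fintype.card_subtype, Fintype.card_subtype]
    exact h v
  let e := fun v => (h' v).some
  refine ⟨(Equiv.sigmaFiberEquiv f).symm.trans
    ((Equiv.sigmaCongrRight e).trans (Equiv.sigmaFiberEquiv g)), fun i => ?_⟩
  exact (e (f i) ⟨i, rfl⟩).2

lemma iso_of_mult {G H1 H2 : FinGraph} {f1 : Fin H1.n → Fin G.n} {f2 : Fin H2.n → Fin G.n}
    (h1 : IsPull G H1 f1) (h2 : IsPull G H2 f2) (h : ∀ v, mult f1 v = mult f2 v) :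
    FinGraph.Iso H1 H2 := by
  obtain ⟨e, he⟩ := exists_equiv f1 f2 h
  exact ⟨e, fun i j => by rw [h1, h2, he, he]⟩

lemma mult_pos {G : FinGraph} {k : ℕ} (f : Fin k → Fin G.n) (v : Fin G.n) :
    0 < mult f v ↔ ∃ i, f i = v := by
  simp [mult, Finset.card_pos, Finset.Nonempty]

lemma mult_incl {G : FinGraph} {k : ℕ} (f : Fin k → Fin G.n) (S : Finset (Fin k)) (v : Fin G.n) :
    mult (fun i : Fin S.card => f (S.orderIsoOfFin rfl i).1) v = (S.filter (fun i => f i = v)).card := by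
  unfold mult
  refine Finset.card_bij (fun i _ => (S.orderIsoOfFin rfl i).1) ?_ ?_ ?_
  · intro i hi
    simp only [mem_filter, mem_univ, true_and] at hi ⊢
    exact ⟨(S.orderIsoOfFin rfl i).2, hi⟩
  · intro i _ j _ hij
    exact (S.orderIsoOfFin rfl).injective (Subtype.ext hij)
  · intro b hb
    simp only [mem_filter] at hb
    refine ⟨(S.orderIsoOfFin rfl).symm ⟨b, hb.1⟩, ?_, by simp⟩
    rw [mem_filter]
    exact ⟨mem_univ _, by beta_reduce; rw [OrderIso.apply_symm_apply]; exact hb.2⟩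

lemma pull_core {G H : FinGraph} {f : Fin H.n → Fin G.n} (h : IsPull G H f) :
    ∃ g : Fin H.core.n → Fin G.n, IsPull G H.core g ∧ ∀ v, mult g v = coreMult G (mult f) v := by
  refine ⟨fun i => f ((univ.filter (fun i => ∃ j, H.adj i j = true)).orderIsoOfFin rfl i).1,
    fun i j => h _ _, fun v => ?_⟩
  refine Eq.trans (mult_incl f (univ.filter (fun i => ∃ j, H.adj i j = true)) v) ?_
  unfold coreMult
  rw [Finset.filter_filter]
  split_ifs with hv
  · unfold mult
    congr 1
    ext i
    simp only [mem_filter, mem_univ, true_and, and_iff_right_iff_imp]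
    rintro rfl
    obtain ⟨w, hw, hw'⟩ := hv
    obtain ⟨j, rfl⟩ := (mult_pos f w).1 hw
    exact ⟨j, by rw [h]; exact hw'⟩
  · rw [Finset.card_eq_zero, Finset.filter_eq_empty_iff]
    rintro i - ⟨⟨j, hj⟩, rfl⟩
    exact hv ⟨f j, (mult_pos f _).2 ⟨j, rfl⟩, by rw [← h]; exact hj⟩

lemma cls_eq {G H1 H2 : FinGraph} {f1 : Fin H1.n → Fin G.n} {f2 : Fin H2.n → Fin G.n}
    (h1 : IsPull G H1 f1) (h2 : IsPull G H2 f2)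
    {y1 y2 : Fin G.n → ℕ} (e1 : mult f1 = y1) (e2 : mult f2 = y2)
    (h : ∀ v, coreMult G y1 v = coreMult G y2 v) :
    H1.core.cls = H2.core.cls := by
  subst e1 e2
  obtain ⟨g1, hg1, hm1⟩ := pull_core h1
  obtain ⟨g2, hg2, hm2⟩ := pull_core h2
  exact Quot.sound (iso_of_mult hg1 hg2 fun v => by rw [hm1, hm2, h])

lemma exists_mult {G : FinGraph} (y : Fin G.n → ℕ) (k : ℕ) (hk : ∑ v, y v = k) :
    ∃ x : Fin k → Fin G.n, ∀ v, mult x v = y v := by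
  subst hk
  have e : Fin (∑ v, y v) ≃ (Σ v, Fin (y v)) := finSigmaFinEquiv.symm
  refine ⟨fun i => (e i).1, fun v => ?_⟩
  unfold mult
  rw [← Fintype.card_subtype,
    Fintype.card_congr (e.subtypeEquiv (q := fun s => s.1 = v) fun a => Iff.rfl),
    Fintype.card_congr (Equiv.sigmaSubtype (β := fun v => Fin (y v)) v), Fintype.card_fin]

noncomputable def Phi (G : FinGraph) (y : Fin G.n → ℕ) : UGraph :=
  (seqGraph G _ (exists_mult y _ rfl).choose).core.cls

lemma Phi_congr {G : FinGraph} {y z : Fin G.n → ℕ} (h : ∀ v, coreMult G y v = coreMult G z v) :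
    Phi G y = Phi G z := by
  refine cls_eq (G := G) (f1 := (exists_mult y _ rfl).choose) (f2 := (exists_mult z _ rfl).choose)
    (fun i j => rfl) (fun i j => rfl) (funext (exists_mult y _ rfl).choose_spec)
    (funext (exists_mult z _ rfl).choose_spec) h

lemma Phi_pull {G H : FinGraph} {f : Fin H.n → Fin G.n} (h : IsPull G H f) :
    H.core.cls = Phi G (mult f) := by
  refine cls_eq (G := G) (f2 := (exists_mult (mult f) _ rfl).choose) h
    (fun i j => rfl) rfl (funext (exists_mult (mult f) _ rfl).choose_spec) fun _ => rfl

lemma Phi_seq (G : FinGraph) (k : ℕ) (x : Fin k → Fin G.n) :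
    (seqGraph G k x).core.cls = Phi G (mult x) :=
  Phi_pull (H := seqGraph G k x) (f := x) fun _ _ => rfl

lemma Phi_induce (G : FinGraph) (S : Finset (Fin G.n)) :
    (G.induce S).core.cls = Phi G (fun v => if v ∈ S then 1 else 0) := by
  have := Phi_pull (G := G) (H := G.induce S) (f := fun i => (S.orderIsoOfFin rfl i).1)
    fun _ _ => rfl
  rw [this]
  congr 1
  funext v
  refine (mult_incl (G := G) id S v).trans ?_
  simp [Finset.filter_eq']
  split_ifs <;> rfl

/-- the number of sequences with given multiplicities -/
lemma card_fiber {G : FinGraph} (y : Fin G.n → ℕ) (k : ℕ) (hk : ∑ v, y v = k) :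
    (univ.filter (fun x : Fin k → Fin G.n => mult x = y)).card * ∏ v, (y v).factorial
      = k.factorial := by
  obtain ⟨x, hx⟩ := exists_mult y k hk
  have h1 := Finset.card_eq_sum_card_fiberwise (s := (univ : Finset (Equiv.Perm (Fin k))))
    (t := univ.filter (fun x : Fin k → Fin G.n => mult x = y)) (f := fun g : Equiv.Perm (Fin k) => x ∘ g) (by
      intro g _
      simp only [coe_filter, mem_univ, true_and, Set.mem_ofPred_eq]
      funext v
      rw [← hx v]
      unfold mult
      rw [← Fintype.card_subtype, ← Fintype.card_subtype]
      exact Fintype.card_congr (g.subtypeEquiv fun a => Iff.rfl))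
  rw [Finset.card_univ, Fintype.card_perm, Fintype.card_fin] at h1
  rw [h1, Finset.sum_const_nat]
  intro x' hx'
  simp only [mem_filter, mem_univ, true_and] at hx'
  obtain ⟨e, he⟩ := exists_equiv x' x (fun v => by rw [hx', hx v])
  have h2 := DomMulAct.stabilizer_card (f := x)
  simp only [Fintype.card_subtype] at h2
  have h3 : ∀ v, (univ.filter (fun a => x a = v)).card = y v := hx
  simp only [h3] at h2
  rw [← h2]
  refine Finset.card_bij' (fun g _ => e.symm.trans g) (fun g _ => e.trans g) ?_ ?_ ?_ ?_
  · intro g hg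
    simp only [mem_filter, mem_univ, true_and] at hg ⊢
    funext i
    have := congrFun hg (e.symm i)
    simp only [Function.comp_apply, Equiv.trans_apply] at this ⊢
    rw [this, ← he]; simp
  · intro g hg
    simp only [mem_filter, mem_univ, true_and] at hg ⊢
    funext i
    have := congrFun hg (e i)
    simp only [Function.comp_apply, Equiv.trans_apply] at this ⊢
    rw [this, ← he]
  · intro g _; ext; simp
  · intro g _; ext; simp

open MeasureTheory ProbabilityTheory in
lemma hasSum_real_iUnion {Ω ι : Type*} [MeasurableSpace Ω] [DiscreteMeasurableSpace Ω]
    (P : Measure Ω) [IsProbabilityMeasure P] [Countable ι] (s : ι → Set Ω)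
    (hd : ∀ i j, i ≠ j → Disjoint (s i) (s j)) :
    HasSum (fun i => P.real (s i)) (P.real (⋃ i, s i)) := by
  have h1 : P (⋃ i, s i) = ∑' i, P (s i) :=
    measure_iUnion (fun i j hij => hd i j hij) (fun i => .of_discrete)
  have h2 : ∑' i, P (s i) ≠ ⊤ := by rw [← h1]; exact measure_ne_top _ _
  have h3 := ENNReal.hasSum_toReal h2
  rw [← ENNReal.tsum_toReal_eq (fun i => measure_ne_top _ _)] at h3
  convert! h3 using 1
  rw [measureReal_def, h1, ENNReal.tsum_toReal_eq (fun i => measure_ne_top _ _)]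

noncomputable def XX (ω : ℕ × Bool) : ℕ := if 0 < ω.1 ∨ ω.2 = true then 1 else 0

open MeasureTheory ProbabilityTheory in
lemma exists_kappa (p : ℝ) (hp0 : 0 ≤ p) (hp1 : p ≤ 1) :
    ∃ κ : Measure (ℕ × Bool), IsProbabilityMeasure κ ∧
      (∀ y : ℕ, κ.real {ω | ω.1 = y} = Real.exp (-p) * p ^ y / (y.factorial : ℝ)) ∧
      κ.real {ω | XX ω = 1} = p ∧ κ.real {ω | XX ω = 0} = 1 - p ∧
      κ.real {ω | XX ω ≠ ω.1} ≤ p ^ 2 := by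
  lift p to NNReal using hp0
  have hq : (1 - (p : ℝ)) * Real.exp p ≤ 1 := by
    have := Real.add_one_le_exp (-p)
    calc (1 - (p : ℝ)) * Real.exp p ≤ Real.exp (-p) * Real.exp p := by
          gcongr; linarith
      _ = 1 := by rw [← Real.exp_add]; simp
  have hq0 : 0 ≤ (1 - (p : ℝ)) * Real.exp p := mul_nonneg (by linarith) (Real.exp_pos p).le
  let q : unitInterval := ⟨1 - (1 - (p : ℝ)) * Real.exp p, by linarith, by linarith⟩
  let B : Measure Bool := bernoulliMeasure true false q
  have : IsProbabilityMeasure B := by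
    change IsProbabilityMeasure (bernoulliMeasure true false q)
    infer_instance
  let κ := (poissonMeasure p).prod B
  have hκ : IsProbabilityMeasure κ := by
    change IsProbabilityMeasure ((poissonMeasure p).prod B)
    infer_instance
  have hy : ∀ y : ℕ, κ.real {ω | ω.1 = y} = Real.exp (-p) * p ^ y / (y.factorial : ℝ) := by
    intro y
    have : {ω : ℕ × Bool | ω.1 = y} = {y} ×ˢ Set.univ := by ext ⟨a, b⟩; simp
    rw [this, measureReal_prod_prod, poissonMeasure_real_singleton, probReal_univ, mul_one]
  have h0 : κ.real {ω | XX ω = 0} = 1 - p := by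
    have : {ω : ℕ × Bool | XX ω = 0} = {0} ×ˢ {false} := by
      ext ⟨a, b⟩; simp [XX]
    rw [this, measureReal_prod_prod, poissonMeasure_real_singleton,
      bernoulliMeasure_real_apply_of_notMem_of_mem _ (by simp) (by simp) (by simp)]
    simp [q]
    rw [mul_comm, mul_assoc, ← Real.exp_add]; simp
  have h1 : κ.real {ω | XX ω = 1} = p := by
    have : {ω : ℕ × Bool | XX ω = 1} = {ω | XX ω = 0}ᶜ := by
      ext ⟨a, b⟩; simp only [XX, Set.mem_setOf_eq, Set.mem_compl_iff]; split_ifs <;> simp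
    rw [this, probReal_compl_eq_one_sub .of_discrete, h0]; ring
  refine ⟨κ, hκ, hy, h1, h0, ?_⟩
  have : {ω : ℕ × Bool | XX ω ≠ ω.1} = ({ω | XX ω = 0} ∪ {ω | ω.1 = 1})ᶜ := by
    ext ⟨a, b⟩
    simp only [XX, Set.mem_setOf_eq, Set.mem_compl_iff, Set.mem_union]
    cases b <;> rcases a with _ | _ | a <;> simp
  rw [this, probReal_compl_eq_one_sub .of_discrete,
    measureReal_union (by
      rw [Set.disjoint_left]; rintro ⟨a, b⟩ h h'
      simp only [XX, Set.mem_setOf_eq] at h h'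
      simp [h'] at h) .of_discrete, h0, hy]
  have := Real.add_one_le_exp (-p)
  simp
  nlinarith

section
open MeasureTheory ProbabilityTheory

variable {κ : Measure (ℕ × Bool)} [IsProbabilityMeasure κ]

lemma pi_real {n : ℕ} (s : Fin n → Set (ℕ × Bool)) :
    (Measure.pi (fun _ : Fin n => κ)).real {ω | ∀ v, ω v ∈ s v} = ∏ v, κ.real (s v) := by
  have : {ω : Fin n → ℕ × Bool | ∀ v, ω v ∈ s v} = Set.pi Set.univ s := by ext; simp
  rw [this, measureReal_def, Measure.pi_pi, ENNReal.toReal_prod]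
  rfl

lemma law1 (G : FinGraph) (p : ℝ) (hp1 : p ≤ 1)
    (h1 : κ.real {ω | XX ω = 1} = p) (h0 : κ.real {ω | XX ω = 0} = 1 - p) (H : UGraph) :
    pSampleLaw G p H
      = (Measure.pi (fun _ : Fin G.n => κ)).real {ω | Phi G (fun v => XX (ω v)) = H} := by
  have hX : ∀ ω, XX ω = 1 ∨ XX ω = 0 := fun ω => by unfold XX; split_ifs <;> simp
  let f : (Fin G.n → ℕ × Bool) → Finset (Fin G.n) := fun ω => univ.filter (fun v => XX (ω v) = 1)
  have hf : ∀ ω, (fun v => if v ∈ f ω then 1 else 0) = fun v => XX (ω v) := by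
    intro ω; funext v
    simp only [f, mem_filter, mem_univ, true_and]
    rcases hX (ω v) with h | h <;> simp [h]
  have h2 := sum_measureReal_preimage_singleton (μ := Measure.pi (fun _ : Fin G.n => κ))
    (univ.filter (fun S => (G.induce S).core.cls = H)) (f := f) (fun _ _ => .of_discrete)
  have h3 : f ⁻¹' (univ.filter (fun S => (G.induce S).core.cls = H) : Finset (Finset (Fin G.n)))
      = {ω | Phi G (fun v => XX (ω v)) = H} := by
    ext ω
    simp only [Set.mem_preimage, coe_filter, mem_univ, true_and, Set.mem_setOf_eq]
    rw [Phi_induce, hf]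
  rw [h3] at h2
  rw [← h2]
  unfold pSampleLaw
  rw [Finset.powerset_univ, Finset.sum_filter]
  refine Finset.sum_congr rfl fun S _ => ?_
  simp only [mul_ite, mul_one, mul_zero]
  congr 1
  have h4 : f ⁻¹' {S} = {ω | ∀ v, ω v ∈ (if v ∈ S then {ω | XX ω = 1} else {ω | XX ω = 0} : Set _)} := by
    ext ω
    simp only [Set.mem_preimage, Set.mem_singleton_iff, Set.mem_setOf_eq, f, Finset.ext_iff,
      mem_filter, mem_univ, true_and]
    refine forall_congr' fun v => ?_
    rcases hX (ω v) with h | h <;> by_cases hv : v ∈ S <;> simp [h, hv]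
  rw [h4, pi_real]
  unfold sampleWeight
  rw [min_eq_left hp1]
  have h5 : ∀ v, κ.real (if v ∈ S then {ω | XX ω = 1} else {ω | XX ω = 0} : Set _)
      = if v ∈ S then p else 1 - p := by
    intro v; split_ifs <;> assumption
  simp only [h5]
  rw [Finset.prod_ite]
  simp only [prod_const]
  congr 2
  · simp
  · rw [Finset.filter_not, Finset.card_sdiff]; simp

lemma law2 (G : FinGraph) (p : ℝ)
    (hy : ∀ y : ℕ, κ.real {ω | ω.1 = y} = Real.exp (-p) * p ^ y / (y.factorial : ℝ)) (H : UGraph) :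
    wrSampleLaw G p H
      = (Measure.pi (fun _ : Fin G.n => κ)).real {ω | Phi G (fun v => (ω v).1) = H} := by
  have hs := hasSum_real_iUnion (Measure.pi (fun _ : Fin G.n => κ))
    (fun k : ℕ => {ω | Phi G (fun v => (ω v).1) = H ∧ ∑ v, (ω v).1 = k}) (by
      intro i j hij
      rw [Set.disjoint_left]
      rintro ω ⟨-, h⟩ ⟨-, h'⟩
      exact hij (h.symm.trans h'))
  have hu : (⋃ k : ℕ, {ω : Fin G.n → ℕ × Bool | Phi G (fun v => (ω v).1) = H ∧ ∑ v, (ω v).1 = k})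
      = {ω | Phi G (fun v => (ω v).1) = H} := by
    ext ω; simp
  rw [hu] at hs
  rw [← hs.tsum_eq]
  unfold wrSampleLaw
  congr 1
  funext k
  let f : (Fin G.n → ℕ × Bool) → (Fin G.n → ℕ) := fun ω v => (ω v).1
  let T := (Finset.piAntidiag (univ : Finset (Fin G.n)) k).filter (fun y => Phi G y = H)
  have h2 := sum_measureReal_preimage_singleton (μ := Measure.pi (fun _ : Fin G.n => κ))
    T (f := f) (fun _ _ => .of_discrete)
  have h3 : f ⁻¹' (T : Set (Fin G.n → ℕ))
      = {ω | Phi G (fun v => (ω v).1) = H ∧ ∑ v, (ω v).1 = k} := by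
    ext ω
    simp [T, f, and_comm]
  rw [h3] at h2
  rw [← h2]
  have h4 : (univ.filter (fun x : Fin k → Fin G.n => (seqGraph G k x).core.cls = H)).card
      = ∑ y ∈ T, (univ.filter (fun x : Fin k → Fin G.n => mult x = y)).card := by
    rw [Finset.card_eq_sum_card_fiberwise (t := T) (f := fun x => (mult x : Fin G.n → ℕ))]
    · refine Finset.sum_congr rfl fun y hy => ?_
      congr 1
      ext x
      simp only [mem_filter, mem_univ, true_and, and_iff_right_iff_imp]
      rintro rfl
      rw [Phi_seq]
      exact (mem_filter.1 hy).2
    · intro x hx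
      simp only [coe_filter, mem_univ, true_and, Set.mem_setOf_eq] at hx
      simp only [T, coe_filter, Set.mem_setOf_eq, ← Phi_seq, hx, and_true, mem_piAntidiag]
      refine ⟨?_, fun _ _ => mem_univ _⟩
      unfold mult
      rw [← Finset.card_eq_sum_card_fiberwise (fun _ _ => by simp)]
      simp
  rw [h4]
  push_cast
  rw [Finset.sum_div, Finset.mul_sum]
  refine Finset.sum_congr rfl fun y hyT => ?_
  have hyk : ∑ v, y v = k := by
    have := (mem_piAntidiag.1 (mem_filter.1 hyT).1).1
    exact this
  have h5 : f ⁻¹' {y} = {ω | ∀ v, ω v ∈ ({ω | ω.1 = y v} : Set (ℕ × Bool))} := by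
    ext ω
    simp [f, funext_iff]
  rw [h5, pi_real]
  simp only [hy]
  rw [Finset.prod_div_distrib, Finset.prod_mul_distrib, Finset.prod_pow_eq_pow_sum, hyk]
  have h6 := card_fiber y k hyk
  have h7 : ((univ.filter (fun x : Fin k → Fin G.n => mult x = y)).card : ℝ)
      * ∏ v, ((y v).factorial : ℝ) = (k.factorial : ℝ) := by exact_mod_cast h6
  have h8 : (∏ v, ((y v).factorial : ℝ)) ≠ 0 :=
    Finset.prod_ne_zero_iff.2 fun v _ => by positivity
  have h9 : (k.factorial : ℝ) ≠ 0 := by positivity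
  have h10 : ((G.v : ℝ)) ^ k ≠ 0 := by
    unfold FinGraph.v
    rcases Nat.eq_zero_or_pos G.n with h | h
    · have : k = 0 := by
        have : IsEmpty (Fin G.n) := by rw [h]; infer_instance
        rw [← hyk]; simp
      simp [this]
    · positivity
  rw [prod_const, ← Real.exp_nat_mul]
  simp only [card_univ, Fintype.card_fin]
  have : Real.exp (-(p * (G.v : ℝ))) = Real.exp ((G.n : ℝ) * -p) := by
    congr 1; unfold FinGraph.v; ring
  have h11 := left_ne_zero_of_mul (h7 ▸ h9)
  rw [this, mul_pow, ← h7]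
  field_simp

lemma union_bound (G : FinGraph) (p : ℝ) (hp0 : 0 ≤ p)
    (h1 : κ.real {ω | XX ω = 1} = p) (hne : κ.real {ω | XX ω ≠ ω.1} ≤ p ^ 2) :
    (Measure.pi (fun _ : Fin G.n => κ)).real
      {ω | Phi G (fun v => XX (ω v)) ≠ Phi G (fun v => (ω v).1)} ≤
      2 * (G.e : ℝ) * p ^ 3 + (G.loops : ℝ) * p ^ 2 := by
  set P := Measure.pi (fun _ : Fin G.n => κ)
  let E : Finset (Fin G.n × Fin G.n) := univ.filter (fun q => G.adj q.1 q.2 = true ∧ q.1 ≠ q.2)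
  let Lp : Finset (Fin G.n) := univ.filter (fun i => G.adj i i = true)
  have hX1 : ∀ ω : ℕ × Bool, 0 < ω.1 → XX ω = 1 := fun ω h => by simp [XX, h]
  have hX2 : ∀ ω : ℕ × Bool, 0 < XX ω → XX ω = 1 := fun ω h => by
    unfold XX at h ⊢; split_ifs at h ⊢ <;> simp_all
  have hsub : {ω : Fin G.n → ℕ × Bool | Phi G (fun v => XX (ω v)) ≠ Phi G (fun v => (ω v).1)} ⊆
      (⋃ q ∈ E, {ω | XX (ω q.1) ≠ (ω q.1).1 ∧ XX (ω q.2) = 1}) ∪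
        ⋃ i ∈ Lp, {ω | XX (ω i) ≠ (ω i).1} := by
    intro ω hω
    by_contra hcon
    simp only [Set.mem_union, Set.mem_iUnion, Set.mem_setOf_eq, not_or, not_exists, E, Lp,
      mem_filter, mem_univ, true_and] at hcon
    obtain ⟨hc1, hc2⟩ := hcon
    apply hω
    -- key: a bad vertex has no sampled neighbour
    have key : ∀ v w, XX (ω v) ≠ (ω v).1 → G.adj v w = true → XX (ω w) ≠ 1 := by
      intro v w hv hvw hw
      by_cases h : v = w
      · subst h; exact hc2 v hvw hv
      · exact hc1 (v, w) ⟨hvw, h⟩ ⟨hv, hw⟩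
    apply Phi_congr
    intro v
    unfold coreMult
    by_cases hv : XX (ω v) = (ω v).1
    · have : (∃ w, 0 < XX (ω w) ∧ G.adj v w = true) ∨ XX (ω v) = 0 ↔
          (∃ w, 0 < (ω w).1 ∧ G.adj v w = true) ∨ XX (ω v) = 0 := by
        by_cases h0 : XX (ω v) = 0
        · simp [h0]
        simp only [h0, or_false]
        constructor
        · rintro ⟨w, hw, hvw⟩
          refine ⟨w, ?_, hvw⟩
          by_contra hw'
          have hne : XX (ω w) ≠ (ω w).1 := by omega
          exact key w v hne (by rw [G.symm]; exact hvw) (hX2 _ (Nat.pos_of_ne_zero h0))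
        · rintro ⟨w, hw, hvw⟩
          exact ⟨w, by rw [hX1 _ hw]; exact one_pos, hvw⟩
      simp only [← hv]
      by_cases h0 : XX (ω v) = 0
      · simp [h0]
      · simp only [h0, or_false] at this
        simp only [this]
    · rw [if_neg, if_neg]
      · rintro ⟨w, hw, hvw⟩
        exact key v w hv hvw (hX1 _ hw)
      · rintro ⟨w, hw, hvw⟩
        exact key v w hv hvw (hX2 _ hw)
  have hb1 : ∀ q ∈ E, P.real {ω | XX (ω q.1) ≠ (ω q.1).1 ∧ XX (ω q.2) = 1} ≤ p ^ 3 := by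
    intro q hq
    have hq' : q.1 ≠ q.2 := (mem_filter.1 hq).2.2
    have : {ω : Fin G.n → ℕ × Bool | XX (ω q.1) ≠ (ω q.1).1 ∧ XX (ω q.2) = 1} =
        {ω | ∀ v, ω v ∈ (if v = q.1 then {ω | XX ω ≠ ω.1} else
          if v = q.2 then {ω | XX ω = 1} else Set.univ : Set (ℕ × Bool))} := by
      ext ω
      simp only [Set.mem_setOf_eq]
      constructor
      · rintro ⟨ha, hb⟩ v
        split_ifs with h h'
        · subst h; exact ha
        · subst h'; exact hb
        · trivial
      · intro h
        have ha := h q.1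
        have hb := h q.2
        simp only [if_true] at ha
        rw [if_neg hq'.symm, if_pos rfl] at hb
        exact ⟨ha, hb⟩
    rw [this, pi_real]
    rw [← Finset.mul_prod_erase _ _ (mem_univ q.1),
      ← Finset.mul_prod_erase _ _ (mem_erase.2 ⟨hq'.symm, mem_univ q.2⟩)]
    rw [if_pos rfl, if_neg hq'.symm, if_pos rfl, h1, Finset.prod_eq_one]
    · calc _ ≤ p ^ 2 * (p * 1) := by gcongr
        _ = p ^ 3 := by ring
    · intro v hv
      simp only [mem_erase] at hv
      rw [if_neg hv.2.1, if_neg hv.1]; simp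
  have hb2 : ∀ i ∈ Lp, P.real {ω | XX (ω i) ≠ (ω i).1} ≤ p ^ 2 := by
    intro i _
    have : {ω : Fin G.n → ℕ × Bool | XX (ω i) ≠ (ω i).1} =
        {ω | ∀ v, ω v ∈ (if v = i then {ω | XX ω ≠ ω.1} else Set.univ : Set (ℕ × Bool))} := by
      ext ω
      simp only [Set.mem_setOf_eq]
      constructor
      · intro ha v
        split_ifs with h
        · subst h; exact ha
        · trivial
      · intro h
        have ha := h i
        simp only [if_true] at ha
        exact ha
    rw [this, pi_real]
    rw [← Finset.mul_prod_erase _ _ (mem_univ i), if_pos rfl, Finset.prod_eq_one]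
    · simpa using hne
    · intro v hv
      simp only [mem_erase] at hv
      rw [if_neg hv.1]; simp
  have hE : (E.card : ℝ) = 2 * (G.e : ℝ) := by
    have : E.card = G.e + G.e := by
      unfold FinGraph.e
      have hE' : E = (univ.filter (fun q => G.adj q.1 q.2 = true ∧ q.1 < q.2)) ∪
          (univ.filter (fun q => G.adj q.1 q.2 = true ∧ q.2 < q.1)) := by
        ext q
        simp only [E, mem_filter, mem_univ, true_and, mem_union, ← and_or_left, ne_eq]
        rw [← ne_eq, ← lt_or_lt_iff_ne]
      rw [hE', Finset.card_union_of_disjoint]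
      · congr 1
        refine Finset.card_bij' (fun q _ => (q.2, q.1)) (fun q _ => (q.2, q.1)) ?_ ?_ ?_ ?_
        · intro q hq
          simp only [mem_filter, mem_univ, true_and] at hq ⊢
          rw [G.symm]; exact hq
        · intro q hq
          simp only [mem_filter, mem_univ, true_and] at hq ⊢
          rw [G.symm]; exact hq
        · intro q _; rfl
        · intro q _; rfl
      · rw [Finset.disjoint_left]
        intro q h h'
        simp only [mem_filter, mem_univ, true_and] at h h'
        exact lt_asymm h.2 h'.2
    rw [this]; push_cast; ring
  calc _ ≤ P.real ((⋃ q ∈ E, {ω | XX (ω q.1) ≠ (ω q.1).1 ∧ XX (ω q.2) = 1}) ∪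
        ⋃ i ∈ Lp, {ω | XX (ω i) ≠ (ω i).1}) := measureReal_mono hsub
    _ ≤ _ := measureReal_union_le _ _
    _ ≤ E.card * p ^ 3 + Lp.card * p ^ 2 := by
        refine add_le_add ((measureReal_biUnion_finset_le _ _).trans ?_)
          ((measureReal_biUnion_finset_le _ _).trans ?_)
        · exact (Finset.sum_le_card_nsmul _ _ _ hb1).trans (by rw [nsmul_eq_mul])
        · exact (Finset.sum_le_card_nsmul _ _ _ hb2).trans (by rw [nsmul_eq_mul])
    _ = _ := by rw [hE]; rfl

end

instance : Countable FinGraph := by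
  refine Function.Injective.countable (β := Σ n : ℕ, (Fin n → Fin n → Bool))
    (f := fun G => ⟨G.n, G.adj⟩) ?_
  rintro ⟨n, a, h⟩ ⟨m, b, h'⟩ hab
  simp only [Sigma.mk.injEq] at hab
  obtain ⟨rfl, hab⟩ := hab
  rw [heq_iff_eq] at hab
  subst hab
  rfl

instance : Countable UGraph := inferInstanceAs (Countable (Quot FinGraph.Iso))

open MeasureTheory in
lemma tv_bound (G : FinGraph) (p : ℝ) (hp0 : 0 ≤ p) (hp1 : p ≤ 1) (A : Set UGraph) :
    |∑' x : A, (pSampleLaw G p x.1 - wrSampleLaw G p x.1)| ≤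
      2 * (G.e : ℝ) * p ^ 3 + (G.loops : ℝ) * p ^ 2 := by
  obtain ⟨κ, hκ, hy, h1, h0, hne⟩ := exists_kappa p hp0 hp1
  refine le_trans ?_ (union_bound G p hp0 h1 hne)
  set P := Measure.pi (fun _ : Fin G.n => κ) with hP
  have hs : ∀ f : (Fin G.n → ℕ × Bool) → UGraph,
      HasSum (fun x : A => P.real {ω | f ω = x.1}) (P.real {ω | f ω ∈ A}) := by
    intro f
    convert! hasSum_real_iUnion P (fun x : A => {ω | f ω = x.1}) ?_ using 2
    · ext ω; simp
    · intro i j hij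
      rw [Set.disjoint_left]
      intro ω h h'
      exact hij (Subtype.ext (h.symm.trans h'))
  have h2 := (hs (fun ω => Phi G (fun v => XX (ω v)))).sub (hs (fun ω => Phi G (fun v => (ω v).1)))
  simp only [law1 G p hp1 h1 h0, law2 G p hy, ← hP]
  rw [h2.tsum_eq]
  have hle : ∀ f g : (Fin G.n → ℕ × Bool) → UGraph,
      P.real {ω | f ω ∈ A} ≤ P.real {ω | g ω ∈ A} + P.real {ω | f ω ≠ g ω} := by
    intro f g
    refine (measureReal_mono ?_).trans (measureReal_union_le _ _)
    intro ω hω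
    by_cases h : f ω = g ω
    · left; simp only [Set.mem_setOf_eq] at hω ⊢; rw [← h]; exact hω
    · right; exact h
  rw [abs_le]
  have ha := hle (fun ω => Phi G (fun v => XX (ω v))) (fun ω => Phi G (fun v => (ω v).1))
  have hb := hle (fun ω => Phi G (fun v => (ω v).1)) (fun ω => Phi G (fun v => XX (ω v)))
  simp only [ne_comm (a := Phi G (fun v => ((_ : Fin G.n → ℕ × Bool) v).1))] at hb
  constructor <;> linarith

end WR

/-- If `e(G_j) → ∞` and `ℓ(G_j) = O(√(e(G_j)))`, and `p_j = r/√(2e(G_j))`,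
then `d_TV(law of S_{p_j}(G_j), law of S̃_{p_j}(G_j)) → 0`; consequently, for any random
finite unlabeled graph (i.e., any pmf `μ` on unlabeled graphs), `S_{p_j}(G_j)` converges in
distribution to `μ` iff `S̃_{p_j}(G_j)` does. -/
theorem stmt1 (G : ℕ → FinGraph) (r : ℝ) (hr : 0 < r)
    (he : Tendsto (fun j => ((G j).e : ℝ)) atTop atTop)
    (hl : ∃ C : ℝ, ∀ j, ((G j).loops : ℝ) ≤ C * Real.sqrt ((G j).e : ℝ)) :
    Tendsto
        (fun j => dTV (pSampleLaw (G j) (r / Real.sqrt (2 * ((G j).e : ℝ))))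
          (wrSampleLaw (G j) (r / Real.sqrt (2 * ((G j).e : ℝ))))) atTop (nhds 0) ∧
      ∀ μ : UGraph → ℝ, (∀ H, 0 ≤ μ H) → (∑' H : UGraph, μ H) = 1 →
        ((∀ H, Tendsto
            (fun j => pSampleLaw (G j) (r / Real.sqrt (2 * ((G j).e : ℝ))) H)
            atTop (nhds (μ H))) ↔
          (∀ H, Tendsto
            (fun j => wrSampleLaw (G j) (r / Real.sqrt (2 * ((G j).e : ℝ))) H)
            atTop (nhds (μ H)))) := by
  set p : ℕ → ℝ := fun j => r / Real.sqrt (2 * ((G j).e : ℝ)) with hp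
  change Tendsto (fun j => dTV (pSampleLaw (G j) (p j)) (wrSampleLaw (G j) (p j))) atTop (nhds 0) ∧
      ∀ μ : UGraph → ℝ, (∀ H, 0 ≤ μ H) → (∑' H : UGraph, μ H) = 1 →
        ((∀ H, Tendsto (fun j => pSampleLaw (G j) (p j) H) atTop (nhds (μ H))) ↔
          (∀ H, Tendsto (fun j => wrSampleLaw (G j) (p j) H) atTop (nhds (μ H))))
  obtain ⟨C, hC⟩ := hl
  have hp0 : ∀ j, 0 ≤ p j := fun j => div_nonneg hr.le (Real.sqrt_nonneg _)
  have hpt : Tendsto p atTop (nhds 0) := by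
    refine Tendsto.const_div_atTop ?_ r
    exact Real.tendsto_sqrt_atTop.comp (he.const_mul_atTop two_pos)
  have hbt : Tendsto (fun j => (r ^ 2 + |C| * r) * p j) atTop (nhds 0) := by
    simpa using hpt.const_mul (r ^ 2 + |C| * r)
  have hbound : ∀ᶠ j in atTop, ∀ A : Set UGraph,
      |∑' x : A, (pSampleLaw (G j) (p j) x.1 - wrSampleLaw (G j) (p j) x.1)| ≤
        (r ^ 2 + |C| * r) * p j := by
    filter_upwards [hpt.eventually_le_const one_pos, he.eventually_gt_atTop 0] with j h1 h2 A
    refine (WR.tv_bound (G j) (p j) (hp0 j) h1 A).trans ?_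
    set s := Real.sqrt (2 * ((G j).e : ℝ)) with hs
    have hs0 : 0 < s := Real.sqrt_pos.2 (by linarith)
    have hss : s ^ 2 = 2 * ((G j).e : ℝ) := Real.sq_sqrt (by linarith)
    have hps : p j * s = r := div_mul_cancel₀ _ hs0.ne'
    have hl' : ((G j).loops : ℝ) ≤ |C| * s :=
      (hC j).trans (mul_le_mul (le_abs_self C) (Real.sqrt_le_sqrt (by linarith))
        (Real.sqrt_nonneg _) (abs_nonneg C))
    calc 2 * ((G j).e : ℝ) * p j ^ 3 + ((G j).loops : ℝ) * p j ^ 2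
        ≤ s ^ 2 * p j ^ 3 + (|C| * s) * p j ^ 2 := by
          rw [hss]; gcongr
      _ = ((p j * s) ^ 2 + |C| * (p j * s)) * p j := by ring
      _ = _ := by rw [hps]
  refine ⟨?_, fun μ _ _ => ?_⟩
  · refine squeeze_zero' (Eventually.of_forall fun j => ?_) ?_ hbt
    · exact Real.iSup_nonneg fun A => abs_nonneg _
    · filter_upwards [hbound] with j hj
      exact ciSup_le hj
  · have hd : ∀ H, Tendsto (fun j => pSampleLaw (G j) (p j) H - wrSampleLaw (G j) (p j) H)
        atTop (nhds 0) := by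
      intro H
      refine squeeze_zero_norm' ?_ hbt
      filter_upwards [hbound] with j hj
      have := hj {H}
      rw [tsum_singleton H (fun x => pSampleLaw (G j) (p j) x - wrSampleLaw (G j) (p j) x)] at this
      exact this
    constructor
    · intro h H
      simpa using (h H).sub (hd H)
    · intro h H
      simpa using (h H).add (hd H)
end

section
/- Let (G_j) be a sequence of finite loopless graphs with e(G_j) → ∞, fix r > 0, set p_j = r/√(2e(G_j)), and let X_j = e(S_{p_j}(G_j)) be the number of edges of the p_j-sampled subgraph. Then E[X_j] = r²/2 whenever √(2e(G_j)) ≥ r. If the X_j converge in distribution to a random variable X, then E[X] ≤ r²/2, and E[X] = r²/2 holds if and only if the family (X_j) is uniformly integrable, which in turn holds if and only if the sequence (G_j) is uniformly sampling regular. -/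
open Filter Finset
open scoped Classical ENNReal

/-- expectation over the vertex selection -/
noncomputable def EE (G : FinGraph) (p : ℝ) (f : Finset (Fin G.n) → ℝ) : ℝ :=
  ∑ S ∈ (univ : Finset (Fin G.n)).powerset, sampleWeight G p S * f S

noncomputable def aa (G : FinGraph) (i j : Fin G.n) : ℝ := if G.adj i j = true then 1 else 0

noncomputable def ss {n : ℕ} (S : Finset (Fin n)) (i : Fin n) : ℝ := if i ∈ S then 1 else 0

lemma EE_mono (G : FinGraph) (p : ℝ) (hp : 0 ≤ p) (f g : Finset (Fin G.n) → ℝ)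
    (h : ∀ S, f S ≤ g S) : EE G p f ≤ EE G p g := by
  unfold EE
  refine Finset.sum_le_sum fun S _ => mul_le_mul_of_nonneg_left (h S) ?_
  unfold sampleWeight
  have h1 : 0 ≤ min p 1 := le_min hp zero_le_one
  have h2 : 0 ≤ 1 - min p 1 := sub_nonneg.2 (min_le_right _ _)
  positivity

lemma EE_add (G : FinGraph) (p : ℝ) (f g : Finset (Fin G.n) → ℝ) :
    EE G p (fun S => f S + g S) = EE G p f + EE G p g := by
  simp [EE, mul_add, Finset.sum_add_distrib]

lemma EE_sub (G : FinGraph) (p : ℝ) (f g : Finset (Fin G.n) → ℝ) :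
    EE G p (fun S => f S - g S) = EE G p f - EE G p g := by
  simp [EE, mul_sub, Finset.sum_sub_distrib]

lemma EE_smul (G : FinGraph) (p c : ℝ) (f : Finset (Fin G.n) → ℝ) :
    EE G p (fun S => c * f S) = c * EE G p f := by
  simp only [EE, Finset.mul_sum]
  exact Finset.sum_congr rfl fun _ _ => by ring

lemma EE_sum (G : FinGraph) (p : ℝ) {ι : Type*} (t : Finset ι)
    (f : ι → Finset (Fin G.n) → ℝ) :
    EE G p (fun S => ∑ x ∈ t, f x S) = ∑ x ∈ t, EE G p (f x) := by
  simp only [EE, Finset.mul_sum]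
  exact Finset.sum_comm

lemma EE_sub_set (G : FinGraph) (p : ℝ) (T : Finset (Fin G.n)) :
    EE G p (fun S => if T ⊆ S then 1 else 0) = (min p 1) ^ T.card := by
  have h := Finset.prod_add (fun _ : Fin G.n => min p 1)
    (fun i => if i ∈ T then 0 else 1 - min p 1) univ
  have h1 : ∏ i : Fin G.n, (min p 1 + (if i ∈ T then 0 else 1 - min p 1))
      = (min p 1) ^ T.card := by
    have : ∀ i : Fin G.n, (min p 1 + (if i ∈ T then 0 else 1 - min p 1))
      = if i ∈ T then min p 1 else 1 := by intro i; split_ifs <;> ring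
    simp only [this]
    rw [Finset.prod_ite_mem]; simp
  rw [← h1, h]
  unfold EE sampleWeight
  refine Finset.sum_congr rfl fun S _ => ?_
  rw [mul_assoc, Finset.prod_const]
  congr 1
  by_cases hT : T ⊆ S
  · have : ∏ i ∈ univ \ S, (if i ∈ T then 0 else 1 - min p 1)
      = ∏ i ∈ univ \ S, (1 - min p 1) := by
      refine Finset.prod_congr rfl fun i hi => ?_
      have : i ∉ T := fun h => (Finset.mem_sdiff.1 hi).2 (hT h)
      simp [this]
    rw [this, Finset.prod_const, Finset.card_univ_sdiff]
    simp [hT]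
  · obtain ⟨i, hi, hi'⟩ := Finset.not_subset.1 hT
    rw [Finset.prod_eq_zero (i := i)]
    · simp [hT]
    · simp [hi']
    · simp [hi]

lemma EE_s (G : FinGraph) (p : ℝ) (i : Fin G.n) :
    EE G p (fun S => ss S i) = min p 1 := by
  have := EE_sub_set G p {i}
  simpa [ss] using this

lemma EE_s2 (G : FinGraph) (p : ℝ) (i j : Fin G.n) (h : i ≠ j) :
    EE G p (fun S => ss S i * ss S j) = (min p 1) ^ 2 := by
  have := EE_sub_set G p {i, j}
  rw [Finset.card_pair h] at this
  rw [← this]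
  congr 1
  ext S
  simp only [ss, Finset.insert_subset_iff, Finset.singleton_subset_iff]
  split_ifs <;> simp_all

lemma EE_s4 (G : FinGraph) (p : ℝ) (hp : 0 ≤ p) (i j k l : Fin G.n) (h : i ≠ j) (h' : k ≠ l) :
    EE G p (fun S => ss S i * ss S j * (ss S k * ss S l)) ≤
      (min p 1) ^ 4 + (min p 1) ^ 3 * ((if i = k then 1 else 0) + (if i = l then 1 else 0)
        + (if j = k then 1 else 0) + (if j = l then 1 else 0))
      + (min p 1) ^ 2 * ((if i = k ∧ j = l then 1 else 0) + (if i = l ∧ j = k then 1 else 0)) := by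
  have := EE_sub_set G p {i, j, k, l}
  have e1 : EE G p (fun S => ss S i * ss S j * (ss S k * ss S l)) =
      (min p 1) ^ (({i, j, k, l} : Finset (Fin G.n)).card) := by
    rw [← this]
    congr 1
    ext S
    simp only [ss, Finset.insert_subset_iff, Finset.singleton_subset_iff]
    split_ifs <;> simp_all
  rw [e1]
  have h1 : 0 ≤ min p 1 := le_min hp zero_le_one
  generalize min p 1 = q at *
  have q2 := pow_nonneg h1 2
  have q3 := pow_nonneg h1 3
  have q4 := pow_nonneg h1 4
  by_cases a1 : i = k <;> by_cases a2 : i = l <;> by_cases a3 : j = k <;> by_cases a4 : j = l <;>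
    simp_all [Finset.card_insert_of_notMem] <;> nlinarith

lemma two_e (H : FinGraph) (hH : H.Loopless) : 2 * (H.e : ℝ) = ∑ i, ∑ j, aa H i j := by
  have h1 : (H.e : ℝ) = ∑ i, ∑ j, if i < j then aa H i j else 0 := by
    unfold FinGraph.e
    rw [Finset.card_filter, Fintype.sum_prod_type]
    push_cast
    refine Finset.sum_congr rfl fun i _ => Finset.sum_congr rfl fun j _ => ?_
    unfold aa
    split_ifs <;> simp_all
  have h2 : (H.e : ℝ) = ∑ i, ∑ j, if j < i then aa H i j else 0 := by
    rw [h1, Finset.sum_comm]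
    refine Finset.sum_congr rfl fun i _ => Finset.sum_congr rfl fun j _ => ?_
    unfold aa
    rw [H.symm]
  rw [two_mul]
  nth_rw 1 [h1]
  rw [h2, ← Finset.sum_add_distrib]
  refine Finset.sum_congr rfl fun i _ => ?_
  rw [← Finset.sum_add_distrib]
  refine Finset.sum_congr rfl fun j _ => ?_
  rcases lt_trichotomy i j with h | h | h
  · simp [h, h.not_gt]
  · subst h
    simp [aa, hH i]
  · simp [h, h.not_gt]

lemma two_X (G : FinGraph) (hG : G.Loopless) (S : Finset (Fin G.n)) :
    2 * ((G.induce S).e : ℝ) = ∑ i, ∑ j, aa G i j * (ss S i * ss S j) := by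
  rw [two_e (G.induce S) (fun i => hG _)]
  have key : ∀ F : Fin G.n → ℝ, ∑ i : Fin S.card, F (S.orderIsoOfFin rfl i).1 =
      ∑ i, F i * ss S i := by
    intro F
    refine (Equiv.sum_comp (S.orderIsoOfFin rfl).toEquiv (fun x : S => F x.1)).trans ?_
    rw [Finset.sum_coe_sort S F]
    simp [ss]
  have : ∀ i j, aa (G.induce S) i j =
    aa G (S.orderIsoOfFin rfl i).1 (S.orderIsoOfFin rfl j).1 := fun i j => rfl
  simp only [this]
  refine (Finset.sum_congr rfl fun i _ => key _).trans ?_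
  refine (key (fun i => ∑ j, aa G i j * ss S j)).trans ?_
  simp only [Finset.sum_mul]
  refine Finset.sum_congr rfl fun i _ => Finset.sum_congr rfl fun j _ => by ring

lemma deg_eq (G : FinGraph) (hG : G.Loopless) (i : Fin G.n) :
    (G.deg i : ℝ) = ∑ j, aa G i j := by
  unfold FinGraph.deg
  rw [Finset.card_filter]
  push_cast
  refine Finset.sum_congr rfl fun j _ => ?_
  unfold aa
  by_cases h : j = i
  · subst h; simp [hG j]
  · simp [h]

lemma EE_quad (G : FinGraph) (p : ℝ) (b : Fin G.n → Fin G.n → ℝ) (hb : ∀ i, b i i = 0) :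
    EE G p (fun S => ∑ i, ∑ j, b i j * (ss S i * ss S j)) = (min p 1) ^ 2 * ∑ i, ∑ j, b i j := by
  rw [EE_sum, Finset.mul_sum]
  refine Finset.sum_congr rfl fun i _ => ?_
  rw [EE_sum, Finset.mul_sum]
  refine Finset.sum_congr rfl fun j _ => ?_
  rw [EE_smul]
  by_cases h : i = j
  · subst h; simp [hb]
  · rw [EE_s2 _ _ _ _ h]; ring

lemma expEdge_eq (G : FinGraph) (hG : G.Loopless) (p : ℝ) :
    expEdge G p = (min p 1) ^ 2 * G.e := by
  have h : expEdge G p = EE G p (fun S => ((G.induce S).e : ℝ)) := rfl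
  have h2 : (fun S => 2 * ((G.induce S).e : ℝ)) =
    fun S => ∑ i, ∑ j, aa G i j * (ss S i * ss S j) := funext (two_X G hG)
  have h3 := EE_quad G p (aa G) (fun i => by simp [aa, hG i])
  rw [← h2, EE_smul, ← two_e G hG, ← h] at h3
  linarith

lemma EE_sq (G : FinGraph) (p : ℝ) (hp : 0 ≤ p) (b : Fin G.n → Fin G.n → ℝ)
    (hb : ∀ i, b i i = 0) (hs : ∀ i j, b i j = b j i) (h01 : ∀ i j, b i j = 0 ∨ b i j = 1) :
    EE G p (fun S => (∑ i, ∑ j, b i j * (ss S i * ss S j)) ^ 2) ≤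
      (min p 1) ^ 4 * (∑ i, ∑ j, b i j) ^ 2 + 4 * (min p 1) ^ 3 * ∑ i, (∑ j, b i j) ^ 2
        + 2 * (min p 1) ^ 2 * ∑ i, ∑ j, b i j := by
  have e1 : (fun S => (∑ i, ∑ j, b i j * (ss S i * ss S j)) ^ 2) =
    (fun S : Finset (Fin G.n) => ∑ i, ∑ j, ∑ k, ∑ l, (b i j * b k l) * (ss S i * ss S j * (ss S k * ss S l))) := by
    funext S
    rw [pow_two, Finset.sum_mul]
    refine Finset.sum_congr rfl fun i _ => ?_
    rw [Finset.sum_mul]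
    refine Finset.sum_congr rfl fun j _ => ?_
    rw [Finset.mul_sum]
    refine Finset.sum_congr rfl fun k _ => ?_
    rw [Finset.mul_sum]
    refine Finset.sum_congr rfl fun l _ => ?_
    ring
  rw [e1]
  simp only [EE_sum, EE_smul]
  have bd : ∀ i j k l, (b i j * b k l) * EE G p (fun S => ss S i * ss S j * (ss S k * ss S l)) ≤
     (min p 1) ^ 4 * (b i j * b k l) + (min p 1) ^ 3 * ((if i = k then b i j * b k l else 0) + (if i = l then b i j * b k l else 0)
        + (if j = k then b i j * b k l else 0) + (if j = l then b i j * b k l else 0))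
      + (min p 1) ^ 2 * ((if i = k then (if j = l then b i j * b k l else 0) else 0) + (if i = l then (if j = k then b i j * b k l else 0) else 0)) := by
    intro i j k l
    by_cases h : i = j
    · subst h; simp [hb]
    by_cases h' : k = l
    · subst h'; simp [hb]
    have h0 : 0 ≤ b i j * b k l := by
      rcases h01 i j with h | h <;> rcases h01 k l with h' | h' <;> simp [h, h']
    refine (mul_le_mul_of_nonneg_left (EE_s4 G p hp i j k l h h') h0).trans (le_of_eq ?_)
    simp only [ite_and]
    split_ifs <;> ring
  refine (Finset.sum_le_sum fun i _ => Finset.sum_le_sum fun j _ => Finset.sum_le_sum fun k _ =>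
    Finset.sum_le_sum fun l _ => bd i j k l).trans (le_of_eq ?_)
  simp only [Finset.sum_add_distrib, ← Finset.mul_sum]
  have hsq : ∀ i j, b i j * b i j = b i j := by
    intro i j; rcases h01 i j with h | h <;> simp [h]
  have t0 : ∑ i, ∑ j, b i j * ∑ k, ∑ l, b k l = (∑ i, ∑ j, b i j) ^ 2 := by
    simp only [pow_two, ← Finset.sum_mul]
  have t1 : ∑ i, ∑ j, ∑ k, ∑ l, (if i = k then b i j * b k l else 0) = ∑ i, (∑ j, b i j) ^ 2 := by
    refine Finset.sum_congr rfl fun i _ => ?_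
    rw [pow_two, Finset.sum_mul]
    refine Finset.sum_congr rfl fun j _ => ?_
    rw [Finset.sum_comm]
    simp [Finset.mul_sum]
  have t2 : ∑ i, ∑ j, ∑ k, ∑ l, (if i = l then b i j * b k l else 0) = ∑ i, (∑ j, b i j) ^ 2 := by
    rw [← t1]
    refine Finset.sum_congr rfl fun i _ => Finset.sum_congr rfl fun j _ => ?_
    rw [Finset.sum_comm]
    refine Finset.sum_congr rfl fun k _ => Finset.sum_congr rfl fun l _ => ?_
    rw [hs k l]
  have t3 : ∑ i, ∑ j, ∑ k, ∑ l, (if j = k then b i j * b k l else 0) = ∑ i, (∑ j, b i j) ^ 2 := by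
    rw [← t1, Finset.sum_comm]
    refine Finset.sum_congr rfl fun i _ => Finset.sum_congr rfl fun j _ => ?_
    rw [hs i j]
  have t4 : ∑ i, ∑ j, ∑ k, ∑ l, (if j = l then b i j * b k l else 0) = ∑ i, (∑ j, b i j) ^ 2 := by
    rw [← t2, Finset.sum_comm]
    refine Finset.sum_congr rfl fun i _ => Finset.sum_congr rfl fun j _ => ?_
    rw [hs i j]
  have t5 : ∑ i, ∑ j, ∑ k, ∑ l, (if i = k then (if j = l then b i j * b k l else 0) else 0) = ∑ i, ∑ j, b i j := by
    refine Finset.sum_congr rfl fun i _ => Finset.sum_congr rfl fun j _ => ?_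
    rw [Finset.sum_eq_single i]
    · simp [hsq]
    · intro k _ hk; simp [hk.symm]
    · simp
  have t6 : ∑ i, ∑ j, ∑ k, ∑ l, (if i = l then (if j = k then b i j * b k l else 0) else 0) = ∑ i, ∑ j, b i j := by
    refine Finset.sum_congr rfl fun i _ => Finset.sum_congr rfl fun j _ => ?_
    rw [Finset.sum_comm, Finset.sum_eq_single i]
    · simp [hs j i, hsq]
    · intro k _ hk; simp [hk.symm]
    · simp
  rw [t0, t1, t2, t3, t4, t5, t6]
  ring

lemma tail_eq (G : FinGraph) (p M : ℝ) : expEdgeTail G p M =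
    EE G p (fun S => if M < ((G.induce S).e : ℝ) then ((G.induce S).e : ℝ) else 0) := rfl

lemma ss_nonneg {n : ℕ} (S : Finset (Fin n)) (i : Fin n) : 0 ≤ ss S i := by
  unfold ss; split_ifs <;> norm_num

lemma aa_nonneg (G : FinGraph) (i j : Fin G.n) : 0 ≤ aa G i j := by
  unfold aa; split_ifs <;> norm_num

lemma aa_symm (G : FinGraph) (i j : Fin G.n) : aa G i j = aa G j i := by
  unfold aa; rw [G.symm]

/-- Upper bound for the tail expectation -/
lemma tail_upper (G : FinGraph) (hG : G.Loopless) (r : ℝ) (hr : 0 < r) (K M : ℝ) (hK : 0 < K)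
    (hM : 0 < M) :
    expEdgeTail G (r / Real.sqrt (2 * (G.e : ℝ))) M ≤
      (r ^ 4 + 4 * K * r ^ 3 + 2 * r ^ 2) / M + r ^ 2 * ((1 / (G.e : ℝ)) * tailDegSum G K) := by
  set t := Real.sqrt (2 * (G.e : ℝ)) with ht
  have ht0 : 0 ≤ t := Real.sqrt_nonneg _
  have he0 : (0 : ℝ) ≤ G.e := Nat.cast_nonneg _
  have ht2 : t ^ 2 = 2 * (G.e : ℝ) := Real.sq_sqrt (by positivity)
  set p := r / t with hpdef
  have hp : 0 ≤ p := by positivity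
  set q := min p 1 with hq
  have hq0 : 0 ≤ q := le_min hp zero_le_one
  have hqt : q * t ≤ r := by
    rcases ht0.eq_or_lt with h | h
    · rw [← h]; simpa using hr.le
    · calc q * t ≤ p * t := by gcongr; exact min_le_left _ _
        _ = r := by rw [hpdef]; field_simp
  have hqt0 : 0 ≤ q * t := by positivity
  let low : Fin G.n → Prop := fun i => (G.deg i : ℝ) ≤ K * Real.sqrt (G.e : ℝ)
  let b : Fin G.n → Fin G.n → ℝ := fun i j => if low i ∧ low j then aa G i j else 0
  let c : Fin G.n → Fin G.n → ℝ := fun i j => aa G i j - b i j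
  have hbb : ∀ i, b i i = 0 := by intro i; simp [b, aa, hG i]
  have hcc : ∀ i, c i i = 0 := by intro i; simp [c, b, aa, hG i]
  have hbs : ∀ i j, b i j = b j i := by intro i j; simp only [b, aa_symm G i j, and_comm]
  have hb01 : ∀ i j, b i j = 0 ∨ b i j = 1 := by
    intro i j; simp only [b, aa]; split_ifs <;> simp
  have hb0 : ∀ i j, 0 ≤ b i j := by
    intro i j; rcases hb01 i j with h | h <;> simp [h]
  have hba : ∀ i j, b i j ≤ aa G i j := by
    intro i j; simp only [b]; split_ifs
    · exact le_rfl
    · exact aa_nonneg G i j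
  let V : Finset (Fin G.n) → ℝ := fun S => ∑ i, ∑ j, b i j * (ss S i * ss S j)
  let W : Finset (Fin G.n) → ℝ := fun S => ∑ i, ∑ j, c i j * (ss S i * ss S j)
  have hV0 : ∀ S, 0 ≤ V S := fun S => Finset.sum_nonneg fun i _ => Finset.sum_nonneg fun j _ =>
    mul_nonneg (hb0 i j) (mul_nonneg (ss_nonneg S i) (ss_nonneg S j))
  have hW0 : ∀ S, 0 ≤ W S := fun S => Finset.sum_nonneg fun i _ => Finset.sum_nonneg fun j _ =>
    mul_nonneg (sub_nonneg.2 (hba i j)) (mul_nonneg (ss_nonneg S i) (ss_nonneg S j))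
  have hX : ∀ S, 2 * ((G.induce S).e : ℝ) = V S + W S := by
    intro S
    rw [two_X G hG]
    simp only [V, W, ← Finset.sum_add_distrib, c]
    refine Finset.sum_congr rfl fun i _ => Finset.sum_congr rfl fun j _ => by ring
  have step1 : expEdgeTail G p M ≤ EE G p (fun S => M⁻¹ * V S ^ 2 + W S) := by
    rw [tail_eq]
    refine EE_mono G p hp _ _ fun S => ?_
    have h := hX S
    have hv := hV0 S
    have hw := hW0 S
    split_ifs with hlt
    · rcases le_total (W S) (V S) with h1 | h1
      · have : V S ≤ M⁻¹ * V S ^ 2 := by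
          rw [inv_mul_eq_div, le_div_iff₀ hM]; nlinarith
        linarith
      · have : 0 ≤ M⁻¹ * V S ^ 2 := by positivity
        linarith
    · positivity
  rw [EE_add, EE_smul] at step1
  have hsb : ∑ i, ∑ j, b i j ≤ t ^ 2 := by
    rw [ht2, two_e G hG]
    exact Finset.sum_le_sum fun i _ => Finset.sum_le_sum fun j _ => hba i j
  have hsb0 : 0 ≤ ∑ i, ∑ j, b i j := Finset.sum_nonneg fun i _ => Finset.sum_nonneg fun j _ => hb0 i j
  have hrow : ∀ i, ∑ j, b i j ≤ K * t := by
    intro i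
    by_cases hl : low i
    · calc ∑ j, b i j ≤ ∑ j, aa G i j := Finset.sum_le_sum fun j _ => hba i j
        _ = G.deg i := (deg_eq G hG i).symm
        _ ≤ K * Real.sqrt (G.e : ℝ) := hl
        _ ≤ K * t := by
          gcongr
          exact Real.sqrt_le_sqrt (by linarith)
    · simp only [b, hl, false_and, if_false, Finset.sum_const_zero]; positivity
  have hD : ∑ i, (∑ j, b i j) ^ 2 ≤ K * t * t ^ 2 := by
    calc ∑ i, (∑ j, b i j) ^ 2 ≤ ∑ i, (K * t) * ∑ j, b i j := by
          refine Finset.sum_le_sum fun i _ => ?_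
          rw [pow_two]
          exact mul_le_mul_of_nonneg_right (hrow i) (Finset.sum_nonneg fun j _ => hb0 i j)
      _ = K * t * ∑ i, ∑ j, b i j := by rw [Finset.mul_sum]
      _ ≤ _ := by gcongr
  have hEV : EE G p (fun S => V S ^ 2) ≤ r ^ 4 + 4 * K * r ^ 3 + 2 * r ^ 2 := by
    refine (EE_sq G p hp b hbb hbs hb01).trans ?_
    rw [← hq]
    have h1 : q ^ 4 * (∑ i, ∑ j, b i j) ^ 2 ≤ r ^ 4 := by
      calc q ^ 4 * (∑ i, ∑ j, b i j) ^ 2 ≤ q ^ 4 * (t ^ 2) ^ 2 := by gcongr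
        _ = (q * t) ^ 4 := by ring
        _ ≤ r ^ 4 := by gcongr
    have h2 : 4 * q ^ 3 * ∑ i, (∑ j, b i j) ^ 2 ≤ 4 * K * r ^ 3 := by
      calc 4 * q ^ 3 * ∑ i, (∑ j, b i j) ^ 2 ≤ 4 * q ^ 3 * (K * t * t ^ 2) := by gcongr
        _ = 4 * K * (q * t) ^ 3 := by ring
        _ ≤ 4 * K * r ^ 3 := by gcongr
    have h3 : 2 * q ^ 2 * ∑ i, ∑ j, b i j ≤ 2 * r ^ 2 := by
      calc 2 * q ^ 2 * ∑ i, ∑ j, b i j ≤ 2 * q ^ 2 * t ^ 2 := by gcongr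
        _ = 2 * (q * t) ^ 2 := by ring
        _ ≤ 2 * r ^ 2 := by gcongr
    linarith
  let τ : Fin G.n → ℝ := fun i => if K * Real.sqrt (G.e : ℝ) < (G.deg i : ℝ) then 1 else 0
  have hc : ∀ i j, c i j ≤ aa G i j * τ i + aa G i j * τ j := by
    intro i j
    have := aa_nonneg G i j
    by_cases h1 : low i <;> by_cases h2 : low j
    · simp [c, b, h1, h2, τ, not_lt.2 h1, not_lt.2 h2]
    · have h2' := not_le.1 h2
      simp [c, b, h1, h2, τ, not_lt.2 h1, h2']
    · have h1' := not_le.1 h1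
      simp [c, b, h1, h2, τ, not_lt.2 h2, h1']
    · have h1' := not_le.1 h1
      have h2' := not_le.1 h2
      simp [c, b, h1, h2, τ, h1', h2', this]
  have htd : ∑ i, ∑ j, aa G i j * τ i = tailDegSum G K := by
    unfold tailDegSum
    refine Finset.sum_congr rfl fun i _ => ?_
    rw [← Finset.sum_mul, ← deg_eq G hG i]
    simp [τ]
  have htd' : ∑ i, ∑ j, aa G i j * τ j = tailDegSum G K := by
    rw [← htd, Finset.sum_comm]
    refine Finset.sum_congr rfl fun i _ => Finset.sum_congr rfl fun j _ => by rw [aa_symm]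
  have hsc : ∑ i, ∑ j, c i j ≤ 2 * tailDegSum G K := by
    refine (Finset.sum_le_sum fun i _ => Finset.sum_le_sum fun j _ => hc i j).trans (le_of_eq ?_)
    simp only [Finset.sum_add_distrib]
    rw [htd, htd']; ring
  have htn : 0 ≤ tailDegSum G K := by
    unfold tailDegSum
    exact Finset.sum_nonneg fun i _ => by split_ifs <;> positivity
  have hEW : EE G p W ≤ r ^ 2 * ((1 / (G.e : ℝ)) * tailDegSum G K) := by
    have := EE_quad G p c hcc
    rw [this, ← hq]
    calc q ^ 2 * ∑ i, ∑ j, c i j ≤ q ^ 2 * (2 * tailDegSum G K) := by gcongr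
      _ ≤ _ := by
        rcases he0.eq_or_lt with h | h
        · have h0 : t = 0 := by rw [ht, ← h]; simp
          have : q = 0 := by rw [hq, hpdef, h0]; simp
          rw [this, ← h]; simp
        · have : q ^ 2 * (2 * (G.e : ℝ)) ≤ r ^ 2 := by
            rw [← ht2, ← mul_pow]; gcongr
          calc q ^ 2 * (2 * tailDegSum G K) =
            (q ^ 2 * (2 * (G.e : ℝ))) * ((1 / (G.e : ℝ)) * tailDegSum G K) := by field_simp
            _ ≤ _ := by gcongr
  have : M⁻¹ * EE G p (fun S => V S ^ 2) ≤ (r ^ 4 + 4 * K * r ^ 3 + 2 * r ^ 2) / M := by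
    rw [div_eq_inv_mul]; gcongr
  calc expEdgeTail G p M ≤ M⁻¹ * EE G p (fun S => V S ^ 2) + EE G p W := step1
    _ ≤ _ := by linarith

/-- Lower bound for the tail expectation -/
lemma tail_lower (G : FinGraph) (hG : G.Loopless) (r : ℝ) (hr : 0 < r) (M : ℝ)
    (hM : 0 < M) (he : 0 < (G.e : ℝ)) (hrt : r ≤ Real.sqrt (2 * (G.e : ℝ))) :
    (1 / (G.e : ℝ)) * tailDegSum G (8 * M / r) ≤
      8 / r ^ 2 * expEdgeTail G (r / Real.sqrt (2 * (G.e : ℝ))) M := by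
  set t := Real.sqrt (2 * (G.e : ℝ)) with ht
  have ht0 : 0 < t := Real.sqrt_pos.2 (by positivity)
  have ht2 : t ^ 2 = 2 * (G.e : ℝ) := Real.sq_sqrt (by positivity)
  set p := r / t with hpdef
  have hp : 0 < p := by positivity
  have hp1 : min p 1 = p := min_eq_left ((div_le_one ht0).2 hrt)
  have hpt : p * t = r := by rw [hpdef]; field_simp
  let Hi : Finset (Fin G.n) := univ.filter fun i =>
    8 * M / r * Real.sqrt (G.e : ℝ) < (G.deg i : ℝ)
  have htd : tailDegSum G (8 * M / r) = ∑ i ∈ Hi, (G.deg i : ℝ) := by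
    simp only [tailDegSum, Hi, Finset.sum_filter]
  have step : EE G p (fun S => ∑ i ∈ Hi, (∑ j, aa G i j * (ss S i * ss S j) - 2 * M * ss S i)) ≤
      EE G p (fun S => 2 * (if M < ((G.induce S).e : ℝ) then ((G.induce S).e : ℝ) else 0)) := by
    refine EE_mono G p hp.le _ _ fun S => ?_
    have hnn : ∀ i j, 0 ≤ aa G i j * (ss S i * ss S j) := fun i j =>
      mul_nonneg (aa_nonneg G i j) (mul_nonneg (ss_nonneg S i) (ss_nonneg S j))
    have hr0 : ∀ i, 0 ≤ ∑ j, aa G i j * (ss S i * ss S j) := fun i =>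
      Finset.sum_nonneg fun j _ => hnn i j
    split_ifs with h
    · rw [two_X G hG]
      calc _ ≤ ∑ i ∈ Hi, ∑ j, aa G i j * (ss S i * ss S j) := by
            refine Finset.sum_le_sum fun i _ => ?_
            have := mul_nonneg (mul_nonneg zero_le_two hM.le) (ss_nonneg S i)
            linarith
        _ ≤ _ := Finset.sum_le_sum_of_subset_of_nonneg (Finset.subset_univ _) fun i _ _ => hr0 i
    · rw [mul_zero]
      refine Finset.sum_nonpos fun i _ => ?_
      by_cases hi : i ∈ S
      · have h1 : ∑ j, aa G i j * (ss S i * ss S j) ≤ 2 * ((G.induce S).e : ℝ) := by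
          rw [two_X G hG]
          exact Finset.single_le_sum (f := fun i => ∑ j, aa G i j * (ss S i * ss S j))
            (fun i _ => hr0 i) (Finset.mem_univ i)
        have h2 : ss S i = 1 := by simp [ss, hi]
        rw [h2] at h1 ⊢
        linarith
      · have h2 : ss S i = 0 := by simp [ss, hi]
        simp [h2]
  rw [EE_smul, ← tail_eq, EE_sum] at step
  have term : ∀ i ∈ Hi, p ^ 2 / 2 * (G.deg i : ℝ) ≤
      EE G p (fun S => ∑ j, aa G i j * (ss S i * ss S j) - 2 * M * ss S i) := by
    intro i hi
    have hi' : 8 * M / r * Real.sqrt (G.e : ℝ) < (G.deg i : ℝ) := (Finset.mem_filter.1 hi).2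
    rw [EE_sub, EE_smul, EE_s, hp1, EE_sum]
    have : ∑ j, EE G p (fun S => aa G i j * (ss S i * ss S j)) = p ^ 2 * (G.deg i : ℝ) := by
      rw [deg_eq G hG, Finset.mul_sum]
      refine Finset.sum_congr rfl fun j _ => ?_
      rw [EE_smul]
      by_cases h : i = j
      · subst h; simp [aa, hG i]
      · rw [EE_s2 _ _ _ _ h, hp1]; ring
    rw [this]
    have hts : t ≤ 2 * Real.sqrt (G.e : ℝ) := by
      rw [ht]
      refine Real.sqrt_le_iff.2 ⟨by positivity, ?_⟩
      rw [mul_pow, Real.sq_sqrt he.le]; linarith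
    have h4 : 4 * M ≤ p * (G.deg i : ℝ) := by
      calc 4 * M = p * (8 * M / r * (t / 2)) := by
            rw [← hpt]; field_simp; ring
        _ ≤ p * (8 * M / r * Real.sqrt (G.e : ℝ)) := by gcongr; linarith
        _ ≤ _ := by gcongr
    nlinarith
  have h5 : p ^ 2 / 2 * tailDegSum G (8 * M / r) ≤ 2 * expEdgeTail G p M := by
    rw [htd, Finset.mul_sum]
    exact (Finset.sum_le_sum term).trans step
  have hp2 : p ^ 2 = r ^ 2 / (2 * G.e) := by rw [hpdef, div_pow, ht2]
  rw [hp2] at h5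
  have h6 : r ^ 2 * ((1 / (G.e : ℝ)) * tailDegSum G (8 * M / r)) = 4 * (r ^ 2 / (2 * G.e) / 2 * tailDegSum G (8 * M / r)) := by
    field_simp; ring
  rw [div_mul_eq_mul_div (8 : ℝ), le_div_iff₀ (by positivity)]
  linarith

lemma tail_anti (G : FinGraph) (p : ℝ) (hp : 0 ≤ p) {M M' : ℝ} (h : M ≤ M') :
    expEdgeTail G p M' ≤ expEdgeTail G p M := by
  rw [tail_eq, tail_eq]
  refine EE_mono G p hp _ _ fun S => ?_
  split_ifs with h1 h2
  · exact le_rfl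
  · exact absurd (h.trans_lt h1) h2
  · positivity
  · exact le_rfl

lemma tail_zero (G : FinGraph) (p : ℝ) : ∃ M, expEdgeTail G p M = 0 := by
  refine ⟨∑ S : Finset (Fin G.n), ((G.induce S).e : ℝ), ?_⟩
  unfold expEdgeTail
  refine Finset.sum_eq_zero fun S _ => ?_
  have := Finset.single_le_sum (f := fun S : Finset (Fin G.n) => ((G.induce S).e : ℝ))
    (fun i _ => Nat.cast_nonneg _) (Finset.mem_univ S)
  rw [if_neg (not_lt.2 this), mul_zero]

lemma tds_anti (G : FinGraph) {k k' : ℝ} (h : k ≤ k') : tailDegSum G k' ≤ tailDegSum G k := by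
  unfold tailDegSum
  refine Finset.sum_le_sum fun i _ => ?_
  have : k * Real.sqrt (G.e : ℝ) ≤ k' * Real.sqrt (G.e : ℝ) := by gcongr
  split_ifs with h1 h2
  · exact le_rfl
  · exact absurd (this.trans_lt h1) h2
  · positivity
  · exact le_rfl

lemma tds_zero (G : FinGraph) : ∃ k, (1 / (G.e : ℝ)) * tailDegSum G k = 0 := by
  rcases Nat.eq_zero_or_pos G.e with h | h
  · exact ⟨0, by simp [h]⟩
  · refine ⟨∑ i, (G.deg i : ℝ), ?_⟩
    unfold tailDegSum
    rw [Finset.sum_eq_zero, mul_zero]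
    intro i _
    have h1 := Finset.single_le_sum (f := fun i => (G.deg i : ℝ))
      (fun i _ => Nat.cast_nonneg _) (Finset.mem_univ i)
    have h2 : 1 ≤ Real.sqrt (G.e : ℝ) := Real.one_le_sqrt.2 (by exact_mod_cast h)
    have h3 : (0 : ℝ) ≤ G.deg i := Nat.cast_nonneg _
    rw [if_neg (not_lt.2 _)]
    nlinarith

lemma unif (P : ℕ → ℝ → Prop) (mono : ∀ j M M', M ≤ M' → P j M → P j M')
    (h1 : ∀ j, ∃ M, P j M) (M0 : ℝ) (h2 : ∀ᶠ j in atTop, P j M0) :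
    ∃ M, M0 ≤ M ∧ ∀ j, P j M := by
  obtain ⟨J, hJ⟩ := eventually_atTop.1 h2
  choose f hf using h1
  have h0 : 0 ≤ ∑ j ∈ Finset.range J, |f j| := Finset.sum_nonneg fun _ _ => abs_nonneg _
  refine ⟨max M0 (∑ j ∈ Finset.range J, |f j|), le_max_left _ _, fun j => ?_⟩
  rcases le_or_gt J j with h | h
  · exact mono _ _ _ (le_max_left _ _) (hJ j h)
  · refine mono _ _ _ ?_ (hf j)
    refine (le_abs_self _).trans (le_trans ?_ (le_max_right _ _))
    exact Finset.single_le_sum (f := fun j => |f j|) (fun _ _ => abs_nonneg _) (Finset.mem_range.2 h)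

lemma split_law (G : FinGraph) (p : ℝ) (N : ℕ) :
    expEdge G p = ∑ m ∈ Finset.range (N + 1), (m : ℝ) * edgeLaw G p m + expEdgeTail G p N := by
  have h1 : ∀ m : ℕ, (m : ℝ) * edgeLaw G p m =
    EE G p (fun S => (m : ℝ) * (if (G.induce S).e = m then 1 else 0)) := by
    intro m; rw [EE_smul]; rfl
  simp only [h1]
  rw [← EE_sum, tail_eq, ← EE_add]
  change EE G p _ = _
  congr 1
  funext S
  simp only [mul_ite, mul_one, mul_zero, Finset.sum_ite_eq, Finset.mem_range, Nat.cast_lt]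
  by_cases h : (G.induce S).e < N + 1
  · rw [if_pos h, if_neg (by omega), add_zero]
  · rw [if_neg h, if_pos (by omega), zero_add]

/-- For loopless graphs with `e(G_j) → ∞`, `r > 0`, `p_j = r/√(2e(G_j))`
and `X_j = e(S_{p_j}(G_j))`: `E[X_j] = r²/2` whenever `√(2e(G_j)) ≥ r`; and if the `X_j`
converge in distribution to a law `μ` on ℕ, then `E[X] ≤ r²/2`, with equality iff the
family `(X_j)` is uniformly integrable, which holds iff `(G_j)` is uniformly sampling
regular. -/
theorem stmt15 (G : ℕ → FinGraph) (hloop : ∀ j, (G j).Loopless)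
    (he : Tendsto (fun j => ((G j).e : ℝ)) atTop atTop)
    (r : ℝ) (hr : 0 < r) :
    (∀ j, r ≤ Real.sqrt (2 * ((G j).e : ℝ)) →
      expEdge (G j) (r / Real.sqrt (2 * ((G j).e : ℝ))) = r ^ 2 / 2) ∧
    ∀ μ : ℕ → ℝ, (∀ m, 0 ≤ μ m) → (∑' m : ℕ, μ m) = 1 →
      (∀ m : ℕ, Tendsto (fun j => edgeLaw (G j) (r / Real.sqrt (2 * ((G j).e : ℝ))) m)
        atTop (nhds (μ m))) →
      ((∑' m : ℕ, (m : ℝ≥0∞) * ENNReal.ofReal (μ m)) ≤ ENNReal.ofReal (r ^ 2 / 2) ∧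
      (((∑' m : ℕ, (m : ℝ≥0∞) * ENNReal.ofReal (μ m)) = ENNReal.ofReal (r ^ 2 / 2)) ↔
        (∀ ε : ℝ, 0 < ε → ∃ M : ℝ, ∀ j,
          expEdgeTail (G j) (r / Real.sqrt (2 * ((G j).e : ℝ))) M ≤ ε)) ∧
      ((∀ ε : ℝ, 0 < ε → ∃ M : ℝ, ∀ j,
          expEdgeTail (G j) (r / Real.sqrt (2 * ((G j).e : ℝ))) M ≤ ε) ↔
        UniformlySamplingRegular G)) := by
  have hpn : ∀ j, 0 ≤ r / Real.sqrt (2 * ((G j).e : ℝ)) := fun j => by positivity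
  have hfirst : ∀ j, r ≤ Real.sqrt (2 * ((G j).e : ℝ)) →
      expEdge (G j) (r / Real.sqrt (2 * ((G j).e : ℝ))) = r ^ 2 / 2 := by
    intro j hj
    have ht0 : 0 < Real.sqrt (2 * ((G j).e : ℝ)) := hr.trans_le hj
    have he0 : (0 : ℝ) < 2 * ((G j).e : ℝ) := Real.sqrt_pos.1 ht0
    rw [expEdge_eq _ (hloop j), min_eq_left ((div_le_one ht0).2 hj), div_pow, Real.sq_sqrt he0.le]
    have : (0 : ℝ) < (G j).e := by linarith
    field_simp
  have hev : ∀ᶠ j in atTop, 0 < ((G j).e : ℝ) ∧ r ≤ Real.sqrt (2 * ((G j).e : ℝ)) := by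
    filter_upwards [he.eventually_ge_atTop 1, he.eventually_ge_atTop (r ^ 2)] with j h1 h2
    refine ⟨by linarith, Real.le_sqrt_of_sq_le (by nlinarith)⟩
  refine ⟨hfirst, fun μ hμ _ hlim => ?_⟩
  have htl : ∀ N : ℕ, Tendsto (fun j => expEdgeTail (G j) (r / Real.sqrt (2 * ((G j).e : ℝ))) N)
      atTop (nhds (r ^ 2 / 2 - ∑ m ∈ Finset.range (N + 1), (m : ℝ) * μ m)) := by
    intro N
    have h1 : Tendsto (fun j => r ^ 2 / 2 - ∑ m ∈ Finset.range (N + 1),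
        (m : ℝ) * edgeLaw (G j) (r / Real.sqrt (2 * ((G j).e : ℝ))) m)
        atTop (nhds (r ^ 2 / 2 - ∑ m ∈ Finset.range (N + 1), (m : ℝ) * μ m)) :=
      tendsto_const_nhds.sub (tendsto_finsetSum _ fun m _ => (hlim m).const_mul _)
    refine h1.congr' ?_
    filter_upwards [hev] with j hj
    have h2 := split_law (G j) (r / Real.sqrt (2 * ((G j).e : ℝ))) N
    rw [hfirst j hj.2] at h2
    linarith
  have htn : ∀ j M, 0 ≤ expEdgeTail (G j) (r / Real.sqrt (2 * ((G j).e : ℝ))) M := by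
    intro j M
    rw [tail_eq]
    have h2 := EE_mono (G j) _ (hpn j) (fun _ => 0) (fun S => if M < (((G j).induce S).e : ℝ)
      then (((G j).induce S).e : ℝ) else 0) (fun S => by split_ifs <;> positivity)
    refine le_trans (le_of_eq ?_) h2
    simp [EE]
  have hA : ∀ N : ℕ, ∑ m ∈ Finset.range (N + 1), (m : ℝ) * μ m ≤ r ^ 2 / 2 := by
    intro N
    have := ge_of_tendsto' (htl N) (fun j => htn j N)
    linarith
  have hAE : ∀ N : ℕ, ∑ m ∈ Finset.range (N + 1), (m : ℝ≥0∞) * ENNReal.ofReal (μ m) =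
      ENNReal.ofReal (∑ m ∈ Finset.range (N + 1), (m : ℝ) * μ m) := by
    intro N
    rw [ENNReal.ofReal_sum_of_nonneg (fun m _ => mul_nonneg (Nat.cast_nonneg _) (hμ m))]
    refine Finset.sum_congr rfl fun m _ => ?_
    rw [ENNReal.ofReal_mul (Nat.cast_nonneg _), ENNReal.ofReal_natCast]
  have hT : Tendsto (fun N : ℕ => ENNReal.ofReal (∑ m ∈ Finset.range (N + 1), (m : ℝ) * μ m)) atTop
      (nhds (∑' m : ℕ, (m : ℝ≥0∞) * ENNReal.ofReal (μ m))) := by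
    have := (ENNReal.tendsto_nat_tsum (fun m : ℕ => (m : ℝ≥0∞) * ENNReal.ofReal (μ m))).comp
      (tendsto_add_atTop_nat 1)
    refine this.congr fun N => ?_
    exact hAE N
  have hle : (∑' m : ℕ, (m : ℝ≥0∞) * ENNReal.ofReal (μ m)) ≤ ENNReal.ofReal (r ^ 2 / 2) :=
    le_of_tendsto' hT fun N => ENNReal.ofReal_le_ofReal (hA N)
  refine ⟨hle, ⟨fun heq ε hε => ?_, fun hUI => ?_⟩, ⟨fun hUI ε hε => ?_, fun hUSR ε hε => ?_⟩⟩
  · rw [heq] at hT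
    have hlt : ENNReal.ofReal (r ^ 2 / 2 - ε) < ENNReal.ofReal (r ^ 2 / 2) :=
      (ENNReal.ofReal_lt_ofReal_iff (by positivity)).2 (by linarith)
    obtain ⟨N, hN⟩ := (hT.eventually (lt_mem_nhds hlt)).exists
    have hN' := (ENNReal.ofReal_lt_ofReal_iff'.1 hN).1
    have h3 : ∀ᶠ j in atTop, expEdgeTail (G j) (r / Real.sqrt (2 * ((G j).e : ℝ))) N ≤ ε := by
      have := (htl N).eventually_lt_const (show _ < ε by linarith)
      exact this.mono fun j hj => hj.le
    obtain ⟨M, _, hM⟩ := unif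
      (fun j M => expEdgeTail (G j) (r / Real.sqrt (2 * ((G j).e : ℝ))) M ≤ ε)
      (fun j M M' h h' => (tail_anti _ _ (hpn j) h).trans h')
      (fun j => (tail_zero (G j) _).imp fun M hM => hM.le.trans hε.le) N h3
    exact ⟨M, hM⟩
  · refine le_antisymm hle (ENNReal.le_of_forall_pos_le_add fun ε hε _ => ?_)
    obtain ⟨M, hM⟩ := hUI ε (by exact_mod_cast hε)
    obtain ⟨N, hN⟩ := exists_nat_ge M
    have h1 : r ^ 2 / 2 - ∑ m ∈ Finset.range (N + 1), (m : ℝ) * μ m ≤ ε :=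
      le_of_tendsto' (htl N) fun j => (tail_anti _ _ (hpn j) hN).trans (hM j)
    have h2 : ENNReal.ofReal (∑ m ∈ Finset.range (N + 1), (m : ℝ) * μ m) ≤
        ∑' m : ℕ, (m : ℝ≥0∞) * ENNReal.ofReal (μ m) := by
      rw [← hAE]; exact ENNReal.sum_le_tsum _
    calc ENNReal.ofReal (r ^ 2 / 2) ≤
        ENNReal.ofReal (∑ m ∈ Finset.range (N + 1), (m : ℝ) * μ m + ε) :=
          ENNReal.ofReal_le_ofReal (by linarith)
      _ ≤ ENNReal.ofReal (∑ m ∈ Finset.range (N + 1), (m : ℝ) * μ m) + ENNReal.ofReal ε :=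
          ENNReal.ofReal_add_le
      _ ≤ _ := by
          rw [ENNReal.ofReal_coe_nnreal]
          gcongr
  · obtain ⟨M, hM⟩ := hUI (r ^ 2 * ε / 16) (by positivity)
    have hM1 : 0 < max M 1 := lt_of_lt_of_le one_pos (le_max_right _ _)
    have h3 : ∀ᶠ j in atTop, (1 / ((G j).e : ℝ)) * tailDegSum (G j) (8 * max M 1 / r) < ε := by
      filter_upwards [hev] with j hj
      have h1 := tail_lower (G j) (hloop j) r hr (max M 1) hM1 hj.1 hj.2
      have h2 := (tail_anti (G j) _ (hpn j) (le_max_left M 1)).trans (hM j)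
      refine h1.trans_lt ?_
      calc _ ≤ 8 / r ^ 2 * (r ^ 2 * ε / 16) := by gcongr
        _ = ε / 2 := by field_simp; ring
        _ < ε := by linarith
    obtain ⟨K, hK, hK'⟩ := unif
      (fun j K => (1 / ((G j).e : ℝ)) * tailDegSum (G j) K < ε)
      (fun j K K' h h' => lt_of_le_of_lt
        (mul_le_mul_of_nonneg_left (tds_anti _ h) (by positivity)) h')
      (fun j => (tds_zero (G j)).imp fun K hK => hK.trans_lt hε) _ h3
    exact ⟨K, lt_of_lt_of_le (by positivity) hK, hK'⟩
  · obtain ⟨K, hK, hK'⟩ := hUSR (ε / (2 * r ^ 2)) (by positivity)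
    have hC : 0 < r ^ 4 + 4 * K * r ^ 3 + 2 * r ^ 2 := by positivity
    refine ⟨2 * (r ^ 4 + 4 * K * r ^ 3 + 2 * r ^ 2) / ε, fun j => ?_⟩
    refine (tail_upper (G j) (hloop j) r hr K _ hK (by positivity)).trans ?_
    have h1 := (hK' j).le
    have h2 : r ^ 2 * (1 / ((G j).e : ℝ) * tailDegSum (G j) K) ≤ r ^ 2 * (ε / (2 * r ^ 2)) := by
      gcongr
    have h3 : r ^ 2 * (ε / (2 * r ^ 2)) = ε / 2 := by field_simp
    have h4 : (r ^ 4 + 4 * K * r ^ 3 + 2 * r ^ 2) /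
        (2 * (r ^ 4 + 4 * K * r ^ 3 + 2 * r ^ 2) / ε) = ε / 2 := by
      generalize r ^ 4 + 4 * K * r ^ 3 + 2 * r ^ 2 = C at hC
      field_simp
    linarith
end
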